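/- Let p ≥ 2 and n ≥ 1 be integers and let a₁ > ⋯ > aₙ > 0 be real numbers such that ∑_{j=1}^n a_j^{2k} = 1/(p^{2k}−1) for all 1 ≤ k ≤ n. Let Z ⊂ ℝ be the multiset of the pⁿ values ∑_{j=1}^n a_j x_j as each x_j ranges over {p−1, p−3, …, 1−p}. Then for every polynomial P of degree at most 2n+1, (1/2)∫_{−1}^{1} P(x) dx = p^{−n} ∑_{z ∈ Z} P(z); that is, Z with equal weights p^{−n} is an interpolatory (2n+1)-quadrature formula for the uniform measure on [−1,1]. -/

import Mathlib

/-- The value of `X̃ = ∑ aⱼ xⱼ` when `xⱼ = p - 1 - 2·(x j)` ranges over the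
arithmetic progression `{p-1, p-3, …, 1-p}`. -/
noncomputable def Xsum (p n : ℕ) (a : Fin n → ℝ) (x : Fin n → Fin p) : ℝ :=
  ∑ j, a j * ((p : ℝ) - 1 - 2 * ((x j : ℕ) : ℝ))

namespace PowerSeries

variable {K : Type*} [Field K]

/-- The logarithmic derivative `f' / f` of a formal power series. -/
noncomputable def logDer (f : K⟦X⟧) : K⟦X⟧ := derivative K f * f⁻¹

theorem logDer_mul_self {f : K⟦X⟧} (hf : constantCoeff f ≠ 0) :
    logDer f * f = derivative K f := by
  rw [logDer, mul_assoc, PowerSeries.inv_mul_cancel f hf, mul_one]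

theorem eq_logDer_of_mul_eq {f g : K⟦X⟧} (hf : constantCoeff f ≠ 0)
    (h : g * f = derivative K f) : g = logDer f := by
  rw [logDer, ← h, mul_assoc, PowerSeries.mul_inv_cancel f hf, mul_one]

theorem logDer_mul {f g : K⟦X⟧} (hf : constantCoeff f ≠ 0) (hg : constantCoeff g ≠ 0) :
    logDer (f * g) = logDer f + logDer g := by
  refine (eq_logDer_of_mul_eq (by simp [hf, hg]) ?_).symm
  rw [Derivation.leibniz, ← logDer_mul_self hf, ← logDer_mul_self hg]
  simp only [smul_eq_mul]
  ring

theorem logDer_prod {ι : Type*} (s : Finset ι) (f : ι → K⟦X⟧)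
    (hf : ∀ i ∈ s, constantCoeff (f i) ≠ 0) :
    logDer (∏ i ∈ s, f i) = ∑ i ∈ s, logDer (f i) := by
  classical
  induction s using Finset.induction_on with
  | empty => simp [logDer]
  | insert i s hi ih =>
    have hs : ∀ j ∈ s, constantCoeff (f j) ≠ 0 := fun j hj => hf j (Finset.mem_insert_of_mem hj)
    rw [Finset.prod_insert hi, Finset.sum_insert hi, logDer_mul (hf i (by simp)), ih hs]
    rw [map_prod]
    exact Finset.prod_ne_zero_iff.2 hs

theorem derivative_rescale (c : K) (f : K⟦X⟧) :
    derivative K (rescale c f) = C c * rescale c (derivative K f) := by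
  ext k
  simp only [coeff_derivative, coeff_rescale, coeff_C_mul]
  ring

theorem constantCoeff_rescale (c : K) (f : K⟦X⟧) :
    constantCoeff (rescale c f) = constantCoeff f := by
  rw [← coeff_zero_eq_constantCoeff_apply, coeff_rescale, pow_zero, one_mul,
    coeff_zero_eq_constantCoeff_apply]

theorem logDer_rescale (c : K) {f : K⟦X⟧} (hf : constantCoeff f ≠ 0) :
    logDer (rescale c f) = C c * rescale c (logDer f) := by
  refine (eq_logDer_of_mul_eq (by rwa [constantCoeff_rescale]) ?_).symm
  rw [derivative_rescale, ← logDer_mul_self hf, map_mul, mul_assoc]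

/-- The constant coefficient and the first coefficients of the logarithmic derivative determine
the first coefficients of a power series. -/
theorem coeff_eq_of_coeff_logDer_eq [CharZero K] {f g : K⟦X⟧} (hf : constantCoeff f ≠ 0)
    (h0 : constantCoeff f = constantCoeff g) {N : ℕ}
    (h : ∀ k < N, coeff k (logDer f) = coeff k (logDer g)) :
    ∀ k ≤ N, coeff k f = coeff k g := by
  intro k
  induction k using Nat.strong_induction_on with
  | _ k ih =>
    intro hk
    cases k with
    | zero => simpa using h0
    | succ k =>
      have key : coeff k (derivative K f) = coeff k (derivative K g) := by
        rw [← logDer_mul_self hf, ← logDer_mul_self (h0 ▸ hf), coeff_mul, coeff_mul]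
        refine Finset.sum_congr rfl fun x hx => ?_
        have hx' := Finset.HasAntidiagonal.mem_antidiagonal.1 hx
        rw [h _ (by omega), ih _ (by omega) (by omega)]
      rw [coeff_derivative, coeff_derivative] at key
      exact mul_right_cancel₀ (by exact_mod_cast k.succ_ne_zero) key

/-- The power series of `sinh t / t`. -/
noncomputable def sinhc : ℝ⟦X⟧ :=
  mk fun k => (1 - (-1) ^ (k + 1)) / (2 * (k + 1).factorial)

theorem constantCoeff_sinhc : constantCoeff sinhc = 1 := by
  rw [← coeff_zero_eq_constantCoeff_apply, sinhc, coeff_mk]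
  norm_num

theorem two_mul_X_mul_sinhc :
    C 2 * X * sinhc = rescale 1 (exp ℝ) - rescale (-1) (exp ℝ) := by
  ext k
  rw [mul_assoc, coeff_C_mul, map_sub, coeff_rescale, coeff_rescale, coeff_exp]
  cases k with
  | zero => simp
  | succ k =>
    rw [coeff_succ_X_mul, sinhc, coeff_mk]
    simp
    field_simp

theorem rescale_neg_one_sinhc : rescale (-1) sinhc = sinhc := by
  ext k
  rw [coeff_rescale, sinhc, coeff_mk]
  rcases k.even_or_odd with hk | hk
  · simp [hk.neg_one_pow]
  · simp [hk.add_one.neg_one_pow]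

theorem coeff_logDer_sinhc_of_even {k : ℕ} (hk : Even k) : coeff k (logDer sinhc) = 0 := by
  have h := logDer_rescale (-1) (f := sinhc) (by simp [constantCoeff_sinhc])
  rw [rescale_neg_one_sinhc] at h
  have h' := congrArg (coeff k) h
  rw [coeff_C_mul, coeff_rescale, hk.neg_one_pow] at h'
  linarith

/-- The exponential generating series of the progression `p - 1, p - 3, …, 1 - p`. -/
noncomputable def expProgression (p : ℕ) : ℝ⟦X⟧ :=
  ∑ i : Fin p, rescale ((p : ℝ) - 1 - 2 * ((i : ℕ) : ℝ)) (exp ℝ)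

theorem constantCoeff_expProgression (p : ℕ) : constantCoeff (expProgression p) = p := by
  simp [expProgression, constantCoeff_rescale]

theorem expProgression_mul_sinhc (p : ℕ) :
    expProgression p * sinhc = C (p : ℝ) * rescale (p : ℝ) sinhc := by
  have h : expProgression p * (rescale 1 (exp ℝ) - rescale (-1) (exp ℝ))
      = rescale (p : ℝ) (exp ℝ) - rescale (-(p : ℝ)) (exp ℝ) := by
    rw [expProgression,
      Fin.sum_univ_eq_sum_range (fun i : ℕ => rescale ((p : ℝ) - 1 - 2 * (i : ℝ)) (exp ℝ)) p,
      Finset.sum_mul]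
    have hstep (i : ℕ) : rescale ((p : ℝ) - 1 - 2 * (i : ℝ)) (exp ℝ)
          * (rescale 1 (exp ℝ) - rescale (-1) (exp ℝ))
        = rescale ((p : ℝ) - 2 * (i : ℝ)) (exp ℝ)
          - rescale ((p : ℝ) - 2 * ((i + 1 : ℕ) : ℝ)) (exp ℝ) := by
      rw [mul_sub, exp_mul_exp_eq_exp_add, exp_mul_exp_eq_exp_add]
      congr 3
      · ring
      · push_cast; ring
    rw [Finset.sum_congr rfl fun i _ => hstep i,
      Finset.sum_range_sub' (fun i : ℕ => rescale ((p : ℝ) - 2 * (i : ℝ)) (exp ℝ)) p]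
    congr 3
    · simp
    · ring
  have hr : rescale (p : ℝ) (C 2 * X * sinhc)
      = rescale (p : ℝ) (exp ℝ) - rescale (-(p : ℝ)) (exp ℝ) := by
    rw [two_mul_X_mul_sinhc, map_sub, rescale_rescale, rescale_rescale, one_mul, neg_one_mul]
  have hC : rescale (p : ℝ) (C (2 : ℝ)) = C 2 := by
    ext k
    rw [coeff_rescale, coeff_C]
    split_ifs with hk <;> simp [hk]
  have h2 : (C (2 : ℝ) * X : ℝ⟦X⟧) ≠ 0 := mul_ne_zero (by simp) X_ne_zero
  refine mul_left_cancel₀ h2 ?_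
  rw [← two_mul_X_mul_sinhc, ← hr, map_mul, map_mul, rescale_X, hC] at h
  linear_combination h

theorem coeff_logDer_rescale_expProgression {p : ℕ} (hp : p ≠ 0) (c : ℝ) (k : ℕ) :
    coeff k (logDer (rescale c (expProgression p)))
      = ((p : ℝ) ^ (k + 1) - 1) * c ^ (k + 1) * coeff k (logDer sinhc) := by
  have hs : constantCoeff sinhc ≠ 0 := by simp [constantCoeff_sinhc]
  have hD : constantCoeff (expProgression p) ≠ 0 := by
    simpa [constantCoeff_expProgression] using hp
  have hC : logDer (C (p : ℝ)) = 0 := by simp [logDer]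
  have h := congrArg logDer (expProgression_mul_sinhc p)
  rw [logDer_mul hD hs, logDer_mul (by simpa using hp) (by rwa [constantCoeff_rescale]), hC,
    logDer_rescale _ hs] at h
  have h' := congrArg (coeff k) h
  simp only [map_add, coeff_C_mul, coeff_rescale, map_zero] at h'
  rw [logDer_rescale _ hD, coeff_C_mul, coeff_rescale, ← sub_eq_zero]
  linear_combination c ^ (k + 1) * h'

theorem prod_rescale_exp {ι : Type*} (s : Finset ι) (c : ι → ℝ) :
    ∏ i ∈ s, rescale (c i) (exp ℝ) = rescale (∑ i ∈ s, c i) (exp ℝ) := by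
  classical
  induction s using Finset.induction_on with
  | empty => simp
  | insert i s hi ih =>
    rw [Finset.prod_insert hi, Finset.sum_insert hi, ih, exp_mul_exp_eq_exp_add]

end PowerSeries

open PowerSeries in
theorem sum_rescale_Xsum_exp (p n : ℕ) (a : Fin n → ℝ) :
    ∑ x : Fin n → Fin p, rescale (Xsum p n a x) (exp ℝ)
      = ∏ j, rescale (a j) (expProgression p) := by
  simp only [expProgression, map_sum, rescale_rescale]
  rw [Fintype.prod_sum]
  refine Finset.sum_congr rfl fun x _ => ?_
  rw [prod_rescale_exp, Xsum]
  simp only [mul_comm]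

open PowerSeries in
theorem coeff_prod_rescale_expProgression {p n : ℕ} (hp : p ≠ 0) {a : Fin n → ℝ}
    (hps : ∀ k : ℕ, 1 ≤ k → k ≤ n →
      ((p : ℝ) ^ (2 * k) - 1) * ∑ j, a j ^ (2 * k) = 1) {k : ℕ} (hk : k ≤ 2 * n + 1) :
    coeff k (∏ j, rescale (a j) (expProgression p)) = (p : ℝ) ^ n * coeff k sinhc := by
  have hp' : (p : ℝ) ≠ 0 := by exact_mod_cast hp
  have hD (j : Fin n) : constantCoeff (rescale (a j) (expProgression p)) = p := by
    rw [constantCoeff_rescale, constantCoeff_expProgression]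
  have hs : constantCoeff sinhc ≠ 0 := by simp [constantCoeff_sinhc]
  rw [← coeff_C_mul]
  refine coeff_eq_of_coeff_logDer_eq (N := 2 * n + 1) ?_ ?_ (fun i hi => ?_) k hk
  · simp [map_prod, hD, hp']
  · simp [map_prod, hD, constantCoeff_sinhc]
  have hC : logDer (C ((p : ℝ) ^ n)) = 0 := by
    rw [logDer, derivative_C, zero_mul]
  rw [logDer_prod _ _ (fun j _ => by rw [hD]; exact hp'),
    logDer_mul (by rw [constantCoeff_C]; exact pow_ne_zero n hp') hs, hC, zero_add, map_sum]
  simp only [coeff_logDer_rescale_expProgression hp]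
  rcases i.even_or_odd with he | ⟨m, rfl⟩
  · simp [coeff_logDer_sinhc_of_even he]
  · rw [← Finset.sum_mul, ← Finset.mul_sum, show 2 * m + 1 + 1 = 2 * (m + 1) by ring,
      hps (m + 1) (by omega) (by omega), one_mul]

open PowerSeries in
theorem sum_Xsum_pow {p n : ℕ} (hp : p ≠ 0) {a : Fin n → ℝ}
    (hps : ∀ k : ℕ, 1 ≤ k → k ≤ n →
      ((p : ℝ) ^ (2 * k) - 1) * ∑ j, a j ^ (2 * k) = 1) {k : ℕ} (hk : k ≤ 2 * n + 1) :
    ∑ x : Fin n → Fin p, Xsum p n a x ^ k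
      = (p : ℝ) ^ n * ((1 - (-1) ^ (k + 1)) / (2 * ((k : ℝ) + 1))) := by
  have h := coeff_prod_rescale_expProgression hp hps hk
  rw [← sum_rescale_Xsum_exp, map_sum] at h
  simp only [coeff_rescale, coeff_exp, sinhc, coeff_mk] at h
  rw [← Finset.sum_mul, Nat.factorial_succ] at h
  have hf : (k.factorial : ℝ) ≠ 0 := by exact_mod_cast k.factorial_ne_zero
  have hk1 : (k : ℝ) + 1 ≠ 0 := by positivity
  simp only [eq_ratCast] at h
  push_cast at h
  field_simp at h ⊢
  linear_combination h

theorem stmt_2 (p n : ℕ) (hp : 2 ≤ p) (hn : 1 ≤ n) (a : Fin n → ℝ)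
    (ha : StrictAnti a) (hpos : ∀ j, 0 < a j)
    (hps : ∀ k : ℕ, 1 ≤ k → k ≤ n →
      ∑ j, a j ^ (2 * k) = 1 / ((p : ℝ) ^ (2 * k) - 1))
    (P : Polynomial ℝ) (hP : P.natDegree ≤ 2 * n + 1) :
    (1 / 2) * ∫ x in (-1 : ℝ)..1, P.eval x
      = ((p : ℝ) ^ n)⁻¹ * ∑ x : Fin n → Fin p, P.eval (Xsum p n a x) := by
  have hp0 : p ≠ 0 := by omega
  have hpn : (p : ℝ) ^ n ≠ 0 := pow_ne_zero n (by exact_mod_cast hp0)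
  have hps' : ∀ k : ℕ, 1 ≤ k → k ≤ n →
      ((p : ℝ) ^ (2 * k) - 1) * ∑ j, a j ^ (2 * k) = 1 := fun k hk hkn => by
    have h1 : (1 : ℝ) < (p : ℝ) ^ (2 * k) :=
      one_lt_pow₀ (by exact_mod_cast hp) (by omega)
    rw [hps k hk hkn, mul_one_div_cancel (sub_ne_zero.2 h1.ne')]
  simp only [Polynomial.eval_eq_sum_range' (Nat.lt_succ_of_le hP)]
  rw [intervalIntegral.integral_finsetSum
    fun i _ => (by fun_prop : Continuous fun x : ℝ => P.coeff i * x ^ i).intervalIntegrable _ _,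
    Finset.sum_comm, Finset.mul_sum, Finset.mul_sum]
  refine Finset.sum_congr rfl fun k hk => ?_
  rw [intervalIntegral.integral_const_mul, integral_pow, ← Finset.mul_sum,
    sum_Xsum_pow hp0 hps' (by simpa [Nat.lt_succ_iff] using hk)]
  have hk1 : (k : ℝ) + 1 ≠ 0 := by positivity
  field_simp
  ring
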